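/- arXiv:1107.5340 — 4 statements merged into one kernel-verified Lean document; each statement's English description precedes it below -/
import Mathlib

section
/- For all i, j with 1 ≤ i, j ≤ m+1, the matrix B_i is invertible and B_i⁻¹ · B_j = T_{m−i+2, j}. In particular, B_i⁻¹ · B_j does not depend on the entries n_1,…,n_{m+1} defining S. -/
open Matrix

noncomputable section

/-- Lower triangular Toeplitz m×m matrix: entry (i,j) equals `a (i-j)` (0-based),
i.e. `a_{i-j+1}` in the 1-based notation of the paper, for j ≤ i, and 0 otherwise. -/
def lowT (m : ℕ) (a : Fin (m + 1) → ℝ) : Matrix (Fin m) (Fin m) ℝ :=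
  fun i j =>
    if h : (j : ℕ) ≤ (i : ℕ) then a ⟨(i : ℕ) - (j : ℕ), by have := i.2; omega⟩ else 0

/-- Upper triangular Toeplitz m×m matrix: entry (i,j) equals `a (m + i - j)` (0-based),
i.e. `a_{m+1+i-j}` in the 1-based notation of the paper, for i ≤ j, and 0 otherwise. -/
def upT (m : ℕ) (a : Fin (m + 1) → ℝ) : Matrix (Fin m) (Fin m) ℝ :=
  fun i j =>
    if h : (i : ℕ) ≤ (j : ℕ) then a ⟨m + (i : ℕ) - (j : ℕ), by have := j.2; omega⟩ else 0

/-- The 2m×2m Sylvester matrix S = [[D_L, N_L],[D_U, N_U]]. -/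
def sylv (m : ℕ) (d n : Fin (m + 1) → ℝ) : Matrix (Fin (m + m)) (Fin (m + m)) ℝ :=
  (fromBlocks (lowT m d) (lowT m n) (upT m d) (upT m n)).submatrix
    finSumFinEquiv.symm finSumFinEquiv.symm

/-- The 2m×2m lower triangular matrix D = [[D_L, 0],[D_U, D_L]]. -/
def dMat (m : ℕ) (d : Fin (m + 1) → ℝ) : Matrix (Fin (m + m)) (Fin (m + m)) ℝ :=
  (fromBlocks (lowT m d) (0 : Matrix (Fin m) (Fin m) ℝ) (upT m d) (lowT m d)).submatrix
    finSumFinEquiv.symm finSumFinEquiv.symm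

/-- The m×2m matrix formed by the last m rows of a 2m×2m matrix. -/
def lastRows (m : ℕ) (M : Matrix (Fin (m + m)) (Fin (m + m)) ℝ) :
    Matrix (Fin m) (Fin (m + m)) ℝ :=
  fun i j => M ⟨m + (i : ℕ), by have := i.2; omega⟩ j

/-- The m×m submatrix of an m×2m matrix consisting of the m consecutive columns
starting from column i (0-based; column i+1 in the 1-based notation of the paper). -/
def subCols (m : ℕ) (M : Matrix (Fin m) (Fin (m + m)) ℝ) (i : Fin (m + 1)) :
    Matrix (Fin m) (Fin m) ℝ :=
  fun r c => M r ⟨(i : ℕ) + (c : ℕ), by have := i.2; have := c.2; omega⟩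

/-- The kernel T = ( -D_U·D_L⁻¹ | I_m | -D_L·D_U⁻¹ ), an m×3m matrix. -/
def kerT (m : ℕ) (d : Fin (m + 1) → ℝ) : Matrix (Fin m) (Fin (m + m + m)) ℝ :=
  (fromCols
      (fromCols (-(upT m d * (lowT m d)⁻¹)) (1 : Matrix (Fin m) (Fin m) ℝ))
      (-(lowT m d * (upT m d)⁻¹))).submatrix id
    (((Equiv.sumCongr finSumFinEquiv (Equiv.refl (Fin m))).trans finSumFinEquiv).symm)

/-- T_i : the m×2m submatrix of T consisting of the 2m consecutive columns
starting from column i (0-based). -/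
def tSub (m : ℕ) (d : Fin (m + 1) → ℝ) (i : Fin (m + 1)) :
    Matrix (Fin m) (Fin (m + m)) ℝ :=
  fun r c => kerT m d r ⟨(i : ℕ) + (c : ℕ), by have := i.2; have := c.2; omega⟩

/-- T_{i,j} : the m×m submatrix of T_i consisting of the m consecutive columns
starting from column j (0-based). -/
def tSub2 (m : ℕ) (d : Fin (m + 1) → ℝ) (i j : Fin (m + 1)) :
    Matrix (Fin m) (Fin m) ℝ :=
  fun r c =>
    kerT m d r ⟨(i : ℕ) + (j : ℕ) + (c : ℕ), by have := i.2; have := j.2; have := c.2; omega⟩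

/-- The 2m×m block column matrix [D_L; D_U]. -/
def dlMat (m : ℕ) (d : Fin (m + 1) → ℝ) : Matrix (Fin (m + m)) (Fin m) ℝ :=
  (fromRows (lowT m d) (upT m d)).submatrix finSumFinEquiv.symm id

/-- The 2m×m block column matrix [0; D_L]. -/
def drMat (m : ℕ) (d : Fin (m + 1) → ℝ) : Matrix (Fin (m + m)) (Fin m) ℝ :=
  (fromRows (0 : Matrix (Fin m) (Fin m) ℝ) (lowT m d)).submatrix finSumFinEquiv.symm id

/-- The 2m×m block column matrix [N_L; N_U]. -/
def nMat (m : ℕ) (n : Fin (m + 1) → ℝ) : Matrix (Fin (m + m)) (Fin m) ℝ :=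
  (fromRows (lowT m n) (upT m n)).submatrix finSumFinEquiv.symm id

/-- The 3m×2m block matrix [[X_L, 0],[X_U, X_L],[0, X_U]] built from the
lower/upper triangular Toeplitz matrices of a. -/
def kMat (m : ℕ) (a : Fin (m + 1) → ℝ) : Matrix (Fin (m + m + m)) (Fin (m + m)) ℝ :=
  (fromRows
      (fromRows (fromCols (lowT m a) (0 : Matrix (Fin m) (Fin m) ℝ))
        (fromCols (upT m a) (lowT m a)))
      (fromCols (0 : Matrix (Fin m) (Fin m) ℝ) (upT m a))).submatrix
    (((Equiv.sumCongr finSumFinEquiv (Equiv.refl (Fin m))).trans finSumFinEquiv).symm)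
    finSumFinEquiv.symm

/-- Index reversal i ↦ m - i on 0-based indices, corresponding to the 1-based
index map i ↦ m - i + 2 of the paper. -/
def revIdx (m : ℕ) (i : Fin (m + 1)) : Fin (m + 1) := ⟨m - (i : ℕ), by omega⟩

/-- A lower triangular Toeplitz matrix with nonzero diagonal is invertible. -/
theorem isUnit_det_lowT (m : ℕ) (a : Fin (m + 1) → ℝ) (ha : a 0 ≠ 0) :
    IsUnit (lowT m a).det := by
  have htri : (lowT m a).BlockTriangular OrderDual.toDual := by
    intro i j hij
    have hlt : (i : ℕ) < j := hij
    simp [lowT, not_le.2 hlt]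
  rw [det_of_isLowerTriangular _ htri, isUnit_iff_ne_zero, Finset.prod_ne_zero_iff]
  intro i _
  simpa [lowT] using ha

/-- An upper triangular Toeplitz matrix with nonzero diagonal is invertible. -/
theorem isUnit_det_upT (m : ℕ) (a : Fin (m + 1) → ℝ) (ha : a (Fin.last m) ≠ 0) :
    IsUnit (upT m a).det := by
  have htri : (upT m a).BlockTriangular id := by
    intro i j hij
    have hlt : (j : ℕ) < i := hij
    simp [upT, not_le.2 hlt]
  rw [det_of_isUpperTriangular htri, isUnit_iff_ne_zero, Finset.prod_ne_zero_iff]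
  intro i _
  simpa [upT, Fin.last] using ha

/-- Multiplying a row vector by the block column `[X_L; X_U]` computes the sliding sums
`∑ k, a k * u (c + k)`. -/
theorem sum_lowT_add_sum_upT (m : ℕ) (a : Fin (m + 1) → ℝ) (u : ℕ → ℝ) (c : Fin m) :
    ∑ i : Fin m, u i * lowT m a i c + ∑ i : Fin m, u (m + i) * upT m a i c =
      ∑ k : Fin (m + 1), a k * u (c + k) := by
  obtain ⟨c, hc⟩ := c
  obtain ⟨p, hp⟩ := Nat.exists_eq_add_of_lt hc
  set A : ℕ → ℝ := fun k => if h : k < m + 1 then a ⟨k, h⟩ else 0 with hA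
  have hlow : ∀ i : Fin m, u i * lowT m a i ⟨c, hc⟩ =
      (fun i => u i * if c ≤ i then A (i - c) else 0) (i : ℕ) := by
    intro i
    by_cases hic : c ≤ (i : ℕ)
    · have hi : (i : ℕ) - c < m + 1 := by omega
      simp only [lowT, hA, dif_pos hi, dif_pos hic, if_pos hic]
    · simp [lowT, hic]
  have hup : ∀ i : Fin m, u (m + i) * upT m a i ⟨c, hc⟩ =
      (fun i => u (m + i) * if i ≤ c then A (m + i - c) else 0) (i : ℕ) := by
    intro i
    by_cases hic : (i : ℕ) ≤ c
    · have hi : m + (i : ℕ) - c < m + 1 := by omega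
      simp only [upT, hA, dif_pos hi, dif_pos hic, if_pos hic]
    · simp [upT, hic]
  have hwin : ∀ k : Fin (m + 1), a k * u (c + k) = (fun k => A k * u (c + k)) (k : ℕ) := by
    intro k
    simp only [hA, dif_pos k.2]
  rw [Finset.sum_congr rfl fun i _ => hlow i, Finset.sum_congr rfl fun i _ => hup i,
    Finset.sum_congr rfl fun k _ => hwin k,
    Fin.sum_univ_eq_sum_range (fun i => u i * if c ≤ i then A (i - c) else 0),
    Fin.sum_univ_eq_sum_range (fun i => u (m + i) * if i ≤ c then A (m + i - c) else 0),
    Fin.sum_univ_eq_sum_range (fun k => A k * u (c + k))]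
  have hm1 : m + 1 = (p + 1) + (c + 1) := by omega
  have hm2 : m = c + (p + 1) := by omega
  have hm3 : m = (c + 1) + p := by omega
  rw [hm1, Finset.sum_range_add]
  congr 1
  · conv_lhs => rw [hm2, Finset.sum_range_add]
    rw [Finset.sum_eq_zero, zero_add]
    · refine Finset.sum_congr rfl fun k _ => ?_
      simp [mul_comm]
    · intro k hk
      simp [not_le.2 (Finset.mem_range.1 hk)]
  · conv_lhs => rw [show Finset.range m = Finset.range ((c + 1) + p) by rw [← hm3],
      Finset.sum_range_add]
    rw [add_eq_left.2]
    · refine Finset.sum_congr rfl fun k hk => ?_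
      have hk' : k ≤ c := by have := Finset.mem_range.1 hk; omega
      rw [if_pos hk', mul_comm, show m + k - c = p + 1 + k by omega,
        show m + k = c + (p + 1 + k) by omega]
    · refine Finset.sum_eq_zero fun k _ => ?_
      rw [if_neg (by omega), mul_zero]

/-- A solution of a linear recurrence of order `m` on `2m` consecutive indices which vanishes on
a window of length `m` vanishes everywhere. -/
theorem eq_zero_of_recurrence (m : ℕ) (a : Fin (m + 1) → ℝ) (ha0 : a 0 ≠ 0)
    (ham : a (Fin.last m) ≠ 0) (u : ℕ → ℝ)
    (hrec : ∀ c < m, ∑ k : Fin (m + 1), a k * u (c + k) = 0) (s : ℕ) (hs : s ≤ m)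
    (hwin : ∀ c < m, u (s + c) = 0) : ∀ k < m + m, u k = 0 := by
  have hforward : ∀ k, s ≤ k → k < m + m → u k = 0 := by
    intro k
    induction k using Nat.strong_induction_on with
    | _ k ih =>
      intro hsk hk
      by_cases hks : k < s + m
      · have h := hwin (k - s) (by omega)
        rwa [show s + (k - s) = k by omega] at h
      · have h := hrec (k - m) (by omega)
        rw [Fin.sum_univ_castSucc, Finset.sum_eq_zero, zero_add, Fin.val_last,
          show k - m + m = k by omega] at h
        · exact (mul_eq_zero.1 h).resolve_left ham
        · intro l _
          have hl := l.2
          rw [Fin.val_castSucc, ih _ (by omega) (by omega) (by omega), mul_zero]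
  have hbackward : ∀ t k, s ≤ k + t → k < m + m → u k = 0 := by
    intro t
    induction t with
    | zero => exact hforward
    | succ t ih =>
      intro k hkt hk
      by_cases hsk : s ≤ k + t
      · exact ih k hsk hk
      have h := hrec k (by omega)
      rw [Fin.sum_univ_succ, add_eq_left.2] at h
      · exact (mul_eq_zero.1 h).resolve_left ha0
      · refine Finset.sum_eq_zero fun l _ => ?_
        have hl := l.2
        rw [Fin.val_succ, ih _ (by omega) (by omega), mul_zero]
  exact fun k hk => hbackward s k (by omega) hk

/-- The rows of `kerT` as sequences, extended by zero. -/
def kerSeq (m : ℕ) (d : Fin (m + 1) → ℝ) (r : Fin m) (k : ℕ) : ℝ :=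
  if h : k < m + m + m then kerT m d r ⟨k, h⟩ else 0

theorem kerSeq_left (m : ℕ) (d : Fin (m + 1) → ℝ) (r i : Fin m) :
    kerSeq m d r i = (-(upT m d * (lowT m d)⁻¹)) r i := by
  have hi : (i : ℕ) < m + m + m := by omega
  have hidx : (⟨i, hi⟩ : Fin (m + m + m)) =
      ((Equiv.sumCongr finSumFinEquiv (Equiv.refl (Fin m))).trans finSumFinEquiv)
        (Sum.inl (Sum.inl i)) := by
    ext; simp
  rw [kerSeq, dif_pos hi, hidx, kerT, submatrix_apply, Equiv.symm_apply_apply]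
  rfl

theorem kerSeq_middle (m : ℕ) (d : Fin (m + 1) → ℝ) (r i : Fin m) :
    kerSeq m d r (m + i) = (1 : Matrix (Fin m) (Fin m) ℝ) r i := by
  have hi : m + (i : ℕ) < m + m + m := by omega
  have hidx : (⟨m + i, hi⟩ : Fin (m + m + m)) =
      ((Equiv.sumCongr finSumFinEquiv (Equiv.refl (Fin m))).trans finSumFinEquiv)
        (Sum.inl (Sum.inr i)) := by
    ext; simp [add_comm]
  rw [kerSeq, dif_pos hi, hidx, kerT, submatrix_apply, Equiv.symm_apply_apply]
  rfl

theorem kerSeq_right (m : ℕ) (d : Fin (m + 1) → ℝ) (r i : Fin m) :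
    kerSeq m d r (m + (m + i)) = (-(lowT m d * (upT m d)⁻¹)) r i := by
  have hi : m + (m + (i : ℕ)) < m + m + m := by omega
  have hidx : (⟨m + (m + i), hi⟩ : Fin (m + m + m)) =
      ((Equiv.sumCongr finSumFinEquiv (Equiv.refl (Fin m))).trans finSumFinEquiv)
        (Sum.inr i) := by
    ext; simp [add_assoc]
  rw [kerSeq, dif_pos hi, hidx, kerT, submatrix_apply, Equiv.symm_apply_apply]
  rfl

/-- The rows of `kerT` satisfy the linear recurrence with coefficients `d`. -/
theorem kerSeq_recurrence (m : ℕ) (d : Fin (m + 1) → ℝ) (hd : ∀ k, d k ≠ 0) (r : Fin m) (c : ℕ)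
    (hc : c < m + m) : ∑ k : Fin (m + 1), d k * kerSeq m d r (c + k) = 0 := by
  by_cases hcm : c < m
  · rw [← sum_lowT_add_sum_upT m d (kerSeq m d r) ⟨c, hcm⟩]
    simp_rw [kerSeq_left, kerSeq_middle, ← mul_apply]
    rw [neg_mul, nonsing_inv_mul_cancel_right _ _ (isUnit_det_lowT m d (hd _)), one_mul,
      neg_apply, neg_add_cancel]
  · have h := sum_lowT_add_sum_upT m d (fun k => kerSeq m d r (m + k)) ⟨c - m, by omega⟩
    have hshift : ∀ k, m + (c - m + k) = c + k := by omega
    simp_rw [kerSeq_right, kerSeq_middle, ← mul_apply, hshift] at h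
    rw [← h, neg_mul, nonsing_inv_mul_cancel_right _ _ (isUnit_det_upT m d (hd _)), one_mul,
      neg_apply, add_neg_cancel]

/-- The last `m` rows of `S⁻¹` are annihilated by `[D_L; D_U]`. -/
theorem lastRows_inv_mul_dlMat (m : ℕ) (d n : Fin (m + 1) → ℝ) (hS : IsUnit (sylv m d n)) :
    lastRows m (sylv m d n)⁻¹ * dlMat m d = 0 := by
  ext r c
  have h := congrFun₂ (nonsing_inv_mul _ ((isUnit_iff_isUnit_det _).1 hS))
    (Fin.natAdd m r) (Fin.castAdd m c)
  have hne : Fin.natAdd m r ≠ Fin.castAdd m c := by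
    intro h; have := congrArg Fin.val h; simp at this; omega
  rw [one_apply_ne hne, mul_apply] at h
  rw [mul_apply, Matrix.zero_apply, ← h]
  refine Finset.sum_congr rfl fun x _ => ?_
  rw [sylv, submatrix_apply, dlMat, submatrix_apply, finSumFinEquiv_symm_apply_castAdd]
  rcases finSumFinEquiv.symm x with y | y <;> rfl

/-- The last `m` rows of `S⁻¹` form a left inverse of `[N_L; N_U]`. -/
theorem lastRows_inv_mul_nMat (m : ℕ) (d n : Fin (m + 1) → ℝ) (hS : IsUnit (sylv m d n)) :
    lastRows m (sylv m d n)⁻¹ * nMat m n = 1 := by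
  ext r c
  have h := congrFun₂ (nonsing_inv_mul _ ((isUnit_iff_isUnit_det _).1 hS))
    (Fin.natAdd m r) (Fin.natAdd m c)
  rw [mul_apply] at h
  have hone : (1 : Matrix (Fin (m + m)) (Fin (m + m)) ℝ) (Fin.natAdd m r) (Fin.natAdd m c) =
      (1 : Matrix (Fin m) (Fin m) ℝ) r c := by
    simp [one_apply]
  rw [mul_apply, ← hone, ← h]
  refine Finset.sum_congr rfl fun x _ => ?_
  rw [sylv, submatrix_apply, nMat, submatrix_apply, finSumFinEquiv_symm_apply_natAdd]
  rcases finSumFinEquiv.symm x with y | y <;> rfl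

/-- A matrix annihilated by `[D_L; D_U]` is recovered from any `m` consecutive columns. -/
theorem subCols_mul_tSub (m : ℕ) (d : Fin (m + 1) → ℝ) (hd : ∀ k, d k ≠ 0)
    (M : Matrix (Fin m) (Fin (m + m)) ℝ) (hM : M * dlMat m d = 0) (i : Fin (m + 1)) :
    subCols m M i * tSub m d (revIdx m i) = M := by
  ext r x
  set b : ℕ → ℝ := fun k => if h : k < m + m then M r ⟨k, h⟩ else 0 with hb
  have hbrec : ∀ c < m, ∑ k : Fin (m + 1), d k * b (c + k) = 0 := by
    intro c hc
    have h := congrFun₂ hM r ⟨c, hc⟩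
    rw [mul_apply, Fin.sum_univ_add] at h
    rw [← sum_lowT_add_sum_upT m d b ⟨c, hc⟩]
    refine Eq.trans ?_ h
    congr 1
    · refine Finset.sum_congr rfl fun y _ => ?_
      have hy : (y : ℕ) < m + m := by omega
      rw [dlMat, submatrix_apply, finSumFinEquiv_symm_apply_castAdd]
      simp only [hb, dif_pos hy]
      rfl
    · refine Finset.sum_congr rfl fun y _ => ?_
      have hy : m + (y : ℕ) < m + m := by omega
      rw [dlMat, submatrix_apply, finSumFinEquiv_symm_apply_natAdd]
      simp only [hb, dif_pos hy]
      rfl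
  have hi := i.2
  have hzero := eq_zero_of_recurrence m d (hd _) (hd _)
    (fun k => ∑ s, subCols m M i r s * kerSeq m d s (m - i + k) - b k) ?_ i (by omega) ?_ x x.2
  · have hx := x.2
    simp only [hb, dif_pos hx, sub_eq_zero] at hzero
    rw [mul_apply, ← hzero]
    refine Finset.sum_congr rfl fun s _ => ?_
    rw [kerSeq, dif_pos (by omega)]
    rfl
  · intro c hc
    simp_rw [mul_sub, Finset.sum_sub_distrib, hbrec c hc, sub_zero, Finset.mul_sum]
    rw [Finset.sum_comm]
    refine Finset.sum_eq_zero fun s _ => ?_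
    have h := kerSeq_recurrence m d hd s (m - i + c) (by omega)
    rw [← mul_zero (subCols m M i r s), ← h, Finset.mul_sum]
    exact Finset.sum_congr rfl fun k _ => by rw [mul_left_comm, add_assoc]
  · intro c hc
    have hshift : m - (i : ℕ) + (i + c) = m + c := by omega
    have hlt : (i : ℕ) + c < m + m := by omega
    have hmid : ∀ s, kerSeq m d s (m + c) = (1 : Matrix (Fin m) (Fin m) ℝ) s ⟨c, hc⟩ :=
      fun s => kerSeq_middle m d s ⟨c, hc⟩
    have h := congrFun₂ (mul_one (subCols m M i)) r ⟨c, hc⟩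
    rw [mul_apply] at h
    simp only [hshift, hmid, hb, dif_pos hlt]
    rw [sub_eq_zero]
    exact h

theorem inv_bSub_mul_bSub (m : ℕ) (hm : 1 ≤ m) (d n : Fin (m + 1) → ℝ) (hd : ∀ k, d k ≠ 0) (hn : ∀ k, n k ≠ 0)
    (hS : IsUnit (sylv m d n)) :
    ∀ i j : Fin (m + 1),
      IsUnit (subCols m (lastRows m (sylv m d n)⁻¹) i) ∧
        (subCols m (lastRows m (sylv m d n)⁻¹) i)⁻¹ * subCols m (lastRows m (sylv m d n)⁻¹) j = tSub2 m d (revIdx m i) j := by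
  intro i j
  set M := lastRows m (sylv m d n)⁻¹
  have hT := subCols_mul_tSub m d hd M (lastRows_inv_mul_dlMat m d n hS) i
  have hunit : IsUnit (subCols m M i) := by
    refine IsUnit.of_mul_eq_one (tSub m d (revIdx m i) * nMat m n) ?_
    rw [← Matrix.mul_assoc, hT]
    exact lastRows_inv_mul_nMat m d n hS
  refine ⟨hunit, ?_⟩
  have hj : subCols m M j = subCols m M i * tSub2 m d (revIdx m i) j := by
    ext r c
    have hc := c.2
    have hjlt := j.2
    have h := congrFun₂ hT r ⟨j + c, by omega⟩
    rw [subCols, ← h, mul_apply, mul_apply]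
    refine Finset.sum_congr rfl fun s _ => ?_
    simp only [tSub, tSub2, add_assoc]
  rw [hj, nonsing_inv_mul_cancel_left _ _ ((isUnit_iff_isUnit_det _).1 hunit)]
end
end

section
/- Bezoutian representation of the inverse of a Sylvester matrix: the Bezoutian matrix B_T(D,N) := D_L·N_U − N_L·D_U is invertible, and with B_z := (D_L·N_U − N_L·D_U)⁻¹ the inverse of S is given in block form by S⁻¹ = [[N_U·B_z, −N_L·B_z],[−D_U·B_z, D_L·B_z]]. -/
open Matrix

noncomputable section

/-- Extension by zero of a coefficient vector to all integer indices. -/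
def zeroExt (m : ℕ) (a : Fin (m + 1) → ℝ) (t : ℤ) : ℝ :=
  if h : 0 ≤ t ∧ t ≤ m then a ⟨t.toNat, by omega⟩ else 0

theorem zeroExt_of_neg {m : ℕ} (a : Fin (m + 1) → ℝ) {t : ℤ} (ht : t < 0) :
    zeroExt m a t = 0 :=
  dif_neg (by omega)

theorem zeroExt_of_gt {m : ℕ} (a : Fin (m + 1) → ℝ) {t : ℤ} (ht : (m : ℤ) < t) :
    zeroExt m a t = 0 :=
  dif_neg (by omega)

theorem lowT_apply (m : ℕ) (a : Fin (m + 1) → ℝ) (i j : Fin m) :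
    lowT m a i j = zeroExt m a (i - j) := by
  have := i.2
  unfold lowT zeroExt
  by_cases h : (j : ℕ) ≤ i
  · rw [dif_pos h, dif_pos (by omega)]
    congr 2
    omega
  · rw [dif_neg h, dif_neg (by omega)]

theorem upT_apply (m : ℕ) (a : Fin (m + 1) → ℝ) (i j : Fin m) :
    upT m a i j = zeroExt m a (m + i - j) := by
  have := j.2
  unfold upT zeroExt
  by_cases h : (i : ℕ) ≤ j
  · rw [dif_pos h, dif_pos (by omega)]
    congr 2
    omega
  · rw [dif_neg h, dif_neg (by omega)]

/-- The convolution of two sequences supported on the nonnegative integers is commutative. -/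
theorem sum_range_convolution_comm {x y : ℤ → ℝ} (hx : ∀ t < 0, x t = 0) (hy : ∀ t < 0, y t = 0)
    {N : ℕ} {p j : ℤ} (hj : 0 ≤ j) (hp : p < N) :
    ∑ k ∈ Finset.range N, x (p - k) * y (k - j) =
      ∑ k ∈ Finset.range N, y (p - k) * x (k - j) := by
  have finsum_eq : ∀ {u v : ℤ → ℝ}, (∀ t < 0, u t = 0) → (∀ t < 0, v t = 0) →
      ∑ᶠ k : ℤ, u (p - k) * v (k - j) = ∑ k ∈ Finset.range N, u (p - k) * v (k - j) := by
    intro u v hu hv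
    rw [finsum_eq_sum_of_support_subset (s := (Finset.range N).map Nat.castEmbedding),
      Finset.sum_map]
    · rfl
    · intro k hk
      have h1 : 0 ≤ p - k := by
        by_contra! h
        exact hk (by simp [hu _ h])
      have h2 : 0 ≤ k - j := by
        by_contra! h
        exact hk (by simp [hv _ h])
      simp only [Finset.coe_map, Set.mem_image, Finset.coe_range, Set.mem_Iio]
      exact ⟨k.toNat, by omega, by simp; omega⟩
  rw [← finsum_eq hx hy, ← finsum_eq hy hx, ← finsum_comp_equiv (Equiv.subLeft (p + j))]
  refine finsum_congr fun k => ?_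
  rw [mul_comm, Equiv.subLeft_apply]
  congr 2 <;> ring

theorem lowT_mul_comm (m : ℕ) (a b : Fin (m + 1) → ℝ) :
    lowT m a * lowT m b = lowT m b * lowT m a := by
  ext i j
  have h := sum_range_convolution_comm (x := zeroExt m a) (y := zeroExt m b)
    (fun _ => zeroExt_of_neg a) (fun _ => zeroExt_of_neg b) (N := m) (p := i) (j := j)
    (by omega) (by omega)
  simpa only [mul_apply, lowT_apply, Finset.sum_range] using h

theorem upT_mul_comm (m : ℕ) (a b : Fin (m + 1) → ℝ) :
    upT m a * upT m b = upT m b * upT m a := by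
  ext i j
  have h := sum_range_convolution_comm
    (x := fun t => zeroExt m b (m - t)) (y := fun t => zeroExt m a (m - t))
    (fun _ ht => zeroExt_of_gt b (by omega)) (fun _ ht => zeroExt_of_gt a (by omega))
    (N := m) (p := j) (j := i) (by omega) (by omega)
  simp only [mul_apply, upT_apply]
  simp only [Finset.sum_range, sub_sub_eq_add_sub] at h
  simpa only [mul_comm] using h

theorem upT_mul_lowT_add_lowT_mul_upT_comm (m : ℕ) (a b : Fin (m + 1) → ℝ) :
    upT m a * lowT m b + lowT m a * upT m b = upT m b * lowT m a + lowT m b * upT m a := by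
  ext i j
  have h := sum_range_convolution_comm (x := zeroExt m a) (y := zeroExt m b)
    (fun _ => zeroExt_of_neg a) (fun _ => zeroExt_of_neg b) (N := m + m) (p := m + i) (j := j)
    (by omega) (by push_cast; omega)
  simp only [Finset.sum_range_add, Nat.cast_add, add_sub_add_left_eq_sub] at h
  simp only [Finset.sum_range] at h
  simpa only [Matrix.add_apply, mul_apply, upT_apply, lowT_apply] using h

theorem det_lowT (m : ℕ) (a : Fin (m + 1) → ℝ) : (lowT m a).det = a 0 ^ m := by
  rw [det_of_isLowerTriangular]
  · simp [lowT]
  · intro i j hij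
    exact dif_neg (by simpa using hij)

theorem upT_mul_lowT_sub (m : ℕ) (d n : Fin (m + 1) → ℝ) :
    upT m n * lowT m d - upT m d * lowT m n = lowT m d * upT m n - lowT m n * upT m d := by
  rw [sub_eq_sub_iff_add_eq_add, ← upT_mul_lowT_add_lowT_mul_upT_comm, add_comm]

/-- The determinant of the Sylvester matrix is that of the Bezoutian. -/
theorem det_sylv (m : ℕ) (d n : Fin (m + 1) → ℝ) (hd : d 0 ≠ 0) :
    (sylv m d n).det = (lowT m d * upT m n - lowT m n * upT m d).det := by
  have h : fromBlocks (lowT m d) (lowT m n) (upT m d) (upT m n) *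
      fromBlocks 1 (-lowT m n) 0 (lowT m d) =
      fromBlocks (lowT m d) 0 (upT m d) (lowT m d * upT m n - lowT m n * upT m d) := by
    rw [fromBlocks_multiply, ← upT_mul_lowT_sub, lowT_mul_comm m n d]
    simp [sub_eq_neg_add]
  have hdet := congrArg det h
  rw [det_mul, det_fromBlocks_zero₂₁, det_fromBlocks_zero₁₂, det_one, one_mul, mul_comm] at hdet
  rw [sylv, det_submatrix_equiv_self]
  exact mul_left_cancel₀ (by rw [det_lowT]; exact pow_ne_zero m hd) hdet

theorem bezoutian_inverse (m : ℕ) (hm : 1 ≤ m) (d n : Fin (m + 1) → ℝ) (hd : ∀ k, d k ≠ 0) (hn : ∀ k, n k ≠ 0)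
    (hS : IsUnit (sylv m d n)) :
    IsUnit (lowT m d * upT m n - lowT m n * upT m d) ∧
      (sylv m d n)⁻¹ =
        (fromBlocks
            (upT m n * (lowT m d * upT m n - lowT m n * upT m d)⁻¹)
            (-(lowT m n * (lowT m d * upT m n - lowT m n * upT m d)⁻¹))
            (-(upT m d * (lowT m d * upT m n - lowT m n * upT m d)⁻¹))
            (lowT m d * (lowT m d * upT m n - lowT m n * upT m d)⁻¹)).submatrix
          finSumFinEquiv.symm finSumFinEquiv.symm := by
  have hB : IsUnit (lowT m d * upT m n - lowT m n * upT m d) := by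
    rwa [isUnit_iff_isUnit_det, ← det_sylv m d n (hd 0), ← isUnit_iff_isUnit_det]
  refine ⟨hB, inv_eq_right_inv ?_⟩
  have hBdet := (isUnit_iff_isUnit_det _).1 hB
  have hcomm := upT_mul_lowT_sub m d n
  set B := lowT m d * upT m n - lowT m n * upT m d with hBdef
  rw [sylv, submatrix_mul_equiv, fromBlocks_multiply]
  have h₁₁ : lowT m d * (upT m n * B⁻¹) + lowT m n * -(upT m d * B⁻¹) = 1 := by
    rw [mul_neg, ← sub_eq_add_neg, ← mul_assoc, ← mul_assoc, ← sub_mul, ← hBdef,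
      mul_nonsing_inv _ hBdet]
  have h₁₂ : lowT m d * -(lowT m n * B⁻¹) + lowT m n * (lowT m d * B⁻¹) = 0 := by
    rw [mul_neg, ← mul_assoc, ← mul_assoc, lowT_mul_comm m n d, neg_add_cancel]
  have h₂₁ : upT m d * (upT m n * B⁻¹) + upT m n * -(upT m d * B⁻¹) = 0 := by
    rw [mul_neg, ← mul_assoc, ← mul_assoc, upT_mul_comm m n d, add_neg_cancel]
  have h₂₂ : upT m d * -(lowT m n * B⁻¹) + upT m n * (lowT m d * B⁻¹) = 1 := by
    rw [mul_neg, neg_add_eq_sub, ← mul_assoc, ← mul_assoc, ← sub_mul, hcomm,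
      mul_nonsing_inv _ hBdet]
  rw [h₁₁, h₁₂, h₂₁, h₂₂, fromBlocks_one, submatrix_one_equiv]
end
end

section
/- For all i, j with 1 ≤ i, j ≤ m+1, the matrices B_i and B_j commute: B_i · B_j = B_j · B_i. -/
open Matrix

noncomputable section

open Polynomial in
/-- The polynomial `∑ v i * X ^ i` with coefficient vector `v`. -/
def polyOfVec {k : ℕ} (v : Fin k → ℝ) : ℝ[X] := ∑ i, C (v i) * X ^ (i : ℕ)

open Polynomial in
lemma coeff_polyOfVec {k : ℕ} (v : Fin k → ℝ) (r : ℕ) :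
    (polyOfVec v).coeff r = if h : r < k then v ⟨r, h⟩ else 0 := by
  simp only [polyOfVec, finsetSum_coeff, coeff_C_mul, coeff_X_pow]
  split_ifs with h
  · rw [Finset.sum_eq_single ⟨r, h⟩]
    · simp
    · intro b _ hb
      have : r ≠ b := fun e => hb (Fin.ext e.symm)
      simp [this]
    · simp
  · refine Finset.sum_eq_zero fun b _ => ?_
    have : r ≠ b := by have := b.2; omega
    simp [this]

lemma polyOfVec_injective {k : ℕ} : Function.Injective (polyOfVec (k := k)) := by
  intro v w h
  ext i
  simpa [coeff_polyOfVec] using congrArg (fun p => p.coeff (i : ℕ)) h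

open Polynomial in
lemma degree_polyOfVec_lt {k : ℕ} (v : Fin k → ℝ) : (polyOfVec v).degree < k := by
  rw [degree_lt_iff_coeff_zero]
  intro r hr
  simp [coeff_polyOfVec, not_lt.mpr hr]

open Polynomial in
lemma polyOfVec_mulVec {k l : ℕ} (A : Matrix (Fin k) (Fin l) ℝ) (w : Fin l → ℝ) :
    polyOfVec (A *ᵥ w) = ∑ j, C (w j) * polyOfVec (fun i => A i j) := by
  simp only [polyOfVec, mulVec, dotProduct, map_sum, Finset.sum_mul, Finset.mul_sum, map_mul]
  rw [Finset.sum_comm]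
  exact Finset.sum_congr rfl fun _ _ => Finset.sum_congr rfl fun _ _ => by ring

open Polynomial in
lemma polyOfVec_single {k : ℕ} (j : Fin k) :
    polyOfVec (Pi.single j 1) = X ^ (j : ℕ) := by
  rw [polyOfVec, Finset.sum_eq_single j]
  · simp
  · intro b _ hb
    simp [hb]
  · simp

open Polynomial in
/-- A column of the stacked Toeplitz matrices `[a_L; a_U]` is a shifted copy of `a`. -/
lemma polyOfVec_toeplitz_col (m : ℕ) (a : Fin (m + 1) → ℝ) (j : Fin m) :
    polyOfVec (fun i : Fin (m + m) =>
      Sum.elim (fun r => lowT m a r j) (fun r => upT m a r j) (finSumFinEquiv.symm i)) =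
      X ^ (j : ℕ) * polyOfVec a := by
  ext r
  rw [coeff_X_pow_mul', coeff_polyOfVec, coeff_polyOfVec]
  have hj := j.2
  by_cases hr : r < m + m
  · rw [dif_pos hr]
    by_cases hrm : r < m
    · have e : (⟨r, hr⟩ : Fin (m + m)) = Fin.castAdd m ⟨r, hrm⟩ := rfl
      rw [e, finSumFinEquiv_symm_apply_castAdd]
      simp only [Sum.elim_inl, lowT]
      split_ifs <;> first | rfl | omega
    · have e : (⟨r, hr⟩ : Fin (m + m)) = Fin.natAdd m ⟨r - m, by omega⟩ := by
        ext; simp; omega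
      rw [e, finSumFinEquiv_symm_apply_natAdd]
      simp only [Sum.elim_inr, upT]
      split_ifs <;> first | rfl | omega | (congr 2; omega)
  · rw [dif_neg hr]
    split_ifs <;> first | rfl | omega

open Polynomial in
/-- The Sylvester matrix represents `(p, q) ↦ p * d + q * n`. -/
lemma polyOfVec_sylv_mulVec (m : ℕ) (d n : Fin (m + 1) → ℝ) (w : Fin (m + m) → ℝ) :
    polyOfVec (sylv m d n *ᵥ w) =
      polyOfVec (fun i => w (Fin.castAdd m i)) * polyOfVec d +
        polyOfVec (fun i => w (Fin.natAdd m i)) * polyOfVec n := by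
  have hcol (j : Fin m) : polyOfVec (fun i => sylv m d n i (Fin.castAdd m j)) =
      X ^ (j : ℕ) * polyOfVec d := by
    rw [← polyOfVec_toeplitz_col]
    congr 1; ext i
    simp only [sylv, submatrix_apply, finSumFinEquiv_symm_apply_castAdd]
    cases finSumFinEquiv.symm i <;> rfl
  have hcol' (j : Fin m) : polyOfVec (fun i => sylv m d n i (Fin.natAdd m j)) =
      X ^ (j : ℕ) * polyOfVec n := by
    rw [← polyOfVec_toeplitz_col]
    congr 1; ext i
    simp only [sylv, submatrix_apply, finSumFinEquiv_symm_apply_natAdd]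
    cases finSumFinEquiv.symm i <;> rfl
  rw [polyOfVec_mulVec, Fin.sum_univ_add]
  simp only [hcol, hcol', ← mul_assoc, ← Finset.sum_mul]
  rfl

open Polynomial in
/-- The columns of `S⁻¹` give Bézout representations of the monomials. -/
lemma polyOfVec_sylv_inv_col (m : ℕ) (d n : Fin (m + 1) → ℝ) (hS : IsUnit (sylv m d n))
    (k : Fin (m + m)) :
    polyOfVec (fun i => (sylv m d n)⁻¹ (Fin.castAdd m i) k) * polyOfVec d +
      polyOfVec (fun i => (sylv m d n)⁻¹ (Fin.natAdd m i) k) * polyOfVec n = X ^ (k : ℕ) := by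
  rw [← polyOfVec_single, ← polyOfVec_sylv_mulVec m d n (fun i => (sylv m d n)⁻¹ i k)]
  congr 1
  have h : (fun i => (sylv m d n)⁻¹ i k) = (sylv m d n)⁻¹ *ᵥ Pi.single k 1 := by
    ext i; simp
  rw [h, mulVec_mulVec, mul_nonsing_inv _ ((isUnit_iff_isUnit_det _).mp hS), one_mulVec]

open Polynomial in
/-- `B_i` represents multiplication by `X ^ i * n⁻¹` modulo `d`. -/
lemma polyOfVec_dvd_subCols_mulVec (m : ℕ) (d n : Fin (m + 1) → ℝ) (hS : IsUnit (sylv m d n))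
    (i : Fin (m + 1)) (v : Fin m → ℝ) :
    polyOfVec d ∣ X ^ (i : ℕ) * polyOfVec v -
      polyOfVec (subCols m (lastRows m (sylv m d n)⁻¹) i *ᵥ v) * polyOfVec n := by
  rw [polyOfVec_mulVec, show polyOfVec v = ∑ c, C (v c) * X ^ (c : ℕ) from rfl, Finset.mul_sum,
    Finset.sum_mul, ← Finset.sum_sub_distrib]
  refine Finset.dvd_sum fun c _ => ?_
  have h := polyOfVec_sylv_inv_col m d n hS
    ⟨(i : ℕ) + (c : ℕ), by have := i.2; have := c.2; omega⟩
  refine ⟨C (v c) * polyOfVec (fun r => (sylv m d n)⁻¹ (Fin.castAdd m r)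
    ⟨(i : ℕ) + (c : ℕ), by have := i.2; have := c.2; omega⟩), ?_⟩
  have e : polyOfVec (fun r => subCols m (lastRows m (sylv m d n)⁻¹) i r c) =
      polyOfVec (fun r => (sylv m d n)⁻¹ (Fin.natAdd m r)
        ⟨(i : ℕ) + (c : ℕ), by have := i.2; have := c.2; omega⟩) := rfl
  rw [e]
  simp only [pow_add] at h
  linear_combination (-C (v c)) * h

lemma isCoprime_polyOfVec (m : ℕ) (hm : 1 ≤ m) (d n : Fin (m + 1) → ℝ)
    (hS : IsUnit (sylv m d n)) : IsCoprime (polyOfVec d) (polyOfVec n) :=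
  ⟨_, _, by simpa using polyOfVec_sylv_inv_col m d n hS ⟨0, by omega⟩⟩

open Polynomial in
lemma le_degree_polyOfVec (m : ℕ) (d : Fin (m + 1) → ℝ) (hd : d (Fin.last m) ≠ 0) :
    (m : WithBot ℕ) ≤ (polyOfVec d).degree := by
  refine le_degree_of_ne_zero ?_
  rw [coeff_polyOfVec, dif_pos (Nat.lt_succ_self m)]
  exact hd

open Polynomial in
theorem bSub_commute (m : ℕ) (hm : 1 ≤ m) (d n : Fin (m + 1) → ℝ) (hd : ∀ k, d k ≠ 0) (hn : ∀ k, n k ≠ 0)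
    (hS : IsUnit (sylv m d n)) (hD : IsUnit (dMat m d)) :
    ∀ i j : Fin (m + 1),
      subCols m (lastRows m (sylv m d n)⁻¹) i * subCols m (lastRows m (sylv m d n)⁻¹) j = subCols m (lastRows m (sylv m d n)⁻¹) j * subCols m (lastRows m (sylv m d n)⁻¹) i := by
  intro i j
  refine Matrix.ext_iff_mulVec.mpr fun v => ?_
  rw [← mulVec_mulVec, ← mulVec_mulVec]
  apply polyOfVec_injective
  have key := polyOfVec_dvd_subCols_mulVec m d n hS
  set B := subCols m (lastRows m (sylv m d n)⁻¹)
  have hdvd : polyOfVec d ∣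
      (polyOfVec (B i *ᵥ B j *ᵥ v) - polyOfVec (B j *ᵥ B i *ᵥ v)) * polyOfVec n ^ 2 := by
    obtain ⟨a, ha⟩ := key j v
    obtain ⟨b, hb⟩ := key i v
    obtain ⟨a', ha'⟩ := key i (B j *ᵥ v)
    obtain ⟨b', hb'⟩ := key j (B i *ᵥ v)
    exact ⟨X ^ (j : ℕ) * b - X ^ (i : ℕ) * a + (b' - a') * polyOfVec n, by
      linear_combination (X ^ (j : ℕ)) * hb - (X ^ (i : ℕ)) * ha + polyOfVec n * (hb' - ha')⟩
  have h := (isCoprime_polyOfVec m hm d n hS).pow_right.dvd_of_dvd_mul_right hdvd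
  refine sub_eq_zero.mp (eq_zero_of_dvd_of_degree_lt h ?_)
  exact ((degree_sub_le _ _).trans_lt (max_lt (degree_polyOfVec_lt _)
    (degree_polyOfVec_lt _))).trans_le (le_degree_polyOfVec m d (hd _))
end
end

section
/- For all i, j with 1 ≤ i, j ≤ m+1 and every integer l such that 1 ≤ i+l ≤ m+1 and 1 ≤ j−l ≤ m+1, one has B_i · B_j = B_{i+l} · B_{j−l}. -/
open Matrix

noncomputable section

section ShiftProduct

open Polynomial

theorem ofFn_mulVec {k l : ℕ} (M : Matrix (Fin k) (Fin l) ℝ) (q : Fin l → ℝ) :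
    ofFn k (M *ᵥ q) = ∑ c, C (q c) * ofFn k (fun r => M r c) := by
  have h : M *ᵥ q = ∑ c, q c • fun r => M r c := by
    ext r
    simp [mulVec, dotProduct, mul_comm]
  rw [h, map_sum]
  simp [smul_eq_C_mul]

theorem ofFn_eq_sum_C_mul_X_pow {k : ℕ} (v : Fin k → ℝ) :
    ofFn k v = ∑ c, C (v c) * X ^ (c : ℕ) := by
  simp [ofFn_eq_sum_monomial, C_mul_X_pow_eq_monomial]

theorem ofFn_single {k : ℕ} (c : Fin k) :
    ofFn k (Pi.single c (1 : ℝ)) = X ^ (c : ℕ) := by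
  simp [ofFn_eq_sum_C_mul_X_pow, Pi.single_apply, apply_ite C, ite_mul]

/-- If the stacked matrix `[lowT a; upT a]` is read as a list of polynomials by columns,
its `j`-th column is `X ^ j` times the polynomial with coefficients `a`. -/
theorem ofFn_eq_X_pow_mul_of_blocks {m : ℕ} (a : Fin (m + 1) → ℝ) (j : Fin m)
    (v : Fin (m + m) → ℝ) (hlow : ∀ i, v (Fin.castAdd m i) = lowT m a i j)
    (hup : ∀ i, v (Fin.natAdd m i) = upT m a i j) :
    ofFn (m + m) v = X ^ (j : ℕ) * ofFn (m + 1) a := by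
  ext k
  have hj := j.2
  rw [coeff_X_pow_mul']
  rcases lt_or_ge k m with hk | hk
  · rw [ofFn_coeff_eq_val_of_lt v (by omega)]
    refine (hlow ⟨k, hk⟩).trans ?_
    simp only [lowT]
    split_ifs
    · rw [ofFn_coeff_eq_val_of_lt a (by omega)]
    · rfl
  rcases lt_or_ge k (m + m) with hk' | hk'
  · rw [ofFn_coeff_eq_val_of_lt v hk', if_pos (by omega)]
    have hv : v ⟨k, hk'⟩ = upT m a ⟨k - m, by omega⟩ j := by
      rw [← hup]
      congr 1
      ext
      simp only [Fin.natAdd_mk]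
      omega
    rw [hv]
    simp only [upT]
    split_ifs with h
    · rw [ofFn_coeff_eq_val_of_lt a (by omega)]
      congr 2
      omega
    · rw [ofFn_coeff_eq_zero_of_ge a (by omega)]
  · rw [ofFn_coeff_eq_zero_of_ge v hk', if_pos (by omega), ofFn_coeff_eq_zero_of_ge a (by omega)]

/-- The Sylvester matrix represents `(u, v) ↦ u * d + v * n` on coefficient vectors. -/
theorem ofFn_sylv_mulVec {m : ℕ} (d n : Fin (m + 1) → ℝ) (x : Fin (m + m) → ℝ) :
    ofFn (m + m) (sylv m d n *ᵥ x) =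
      ofFn m (fun i => x (Fin.castAdd m i)) * ofFn (m + 1) d +
        ofFn m (fun i => x (Fin.natAdd m i)) * ofFn (m + 1) n := by
  rw [ofFn_mulVec, Fin.sum_univ_add, ofFn_eq_sum_C_mul_X_pow (k := m),
    ofFn_eq_sum_C_mul_X_pow (k := m), Finset.sum_mul, Finset.sum_mul]
  congr 1
  · refine Finset.sum_congr rfl fun j _ => ?_
    rw [ofFn_eq_X_pow_mul_of_blocks d j _
      (by simp [sylv, -Fin.natAdd_eq_addNat]) (by simp [sylv, -Fin.natAdd_eq_addNat]), mul_assoc]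
  · refine Finset.sum_congr rfl fun j _ => ?_
    rw [ofFn_eq_X_pow_mul_of_blocks n j _
      (by simp [sylv, -Fin.natAdd_eq_addNat]) (by simp [sylv, -Fin.natAdd_eq_addNat]), mul_assoc]

theorem bezout_sylv_inv_col {m : ℕ} {d n : Fin (m + 1) → ℝ} (hS : IsUnit (sylv m d n))
    (k : Fin (m + m)) :
    ofFn m (fun i => (sylv m d n)⁻¹ (Fin.castAdd m i) k) * ofFn (m + 1) d +
      ofFn m (fun i => lastRows m (sylv m d n)⁻¹ i k) * ofFn (m + 1) n = X ^ (k : ℕ) := by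
  have h : sylv m d n *ᵥ (fun r => (sylv m d n)⁻¹ r k) = Pi.single k 1 := by
    ext r
    have := congrFun₂ (mul_nonsing_inv _ ((isUnit_iff_isUnit_det _).1 hS)) r k
    rw [Pi.single_apply, ← one_apply]
    exact this
  rw [← ofFn_single, ← h, ofFn_sylv_mulVec]
  rfl

theorem isCoprime_of_isUnit_sylv {m : ℕ} (hm : 1 ≤ m) {d n : Fin (m + 1) → ℝ}
    (hS : IsUnit (sylv m d n)) : IsCoprime (ofFn (m + 1) d) (ofFn (m + 1) n) :=
  ⟨_, _, by simpa using bezout_sylv_inv_col hS ⟨0, by omega⟩⟩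

/-- Modulo `d`, the matrix `B_i` is multiplication by `X ^ i / n`. -/
theorem dvd_ofFn_subCols_mulVec {m : ℕ} {d n : Fin (m + 1) → ℝ} (hS : IsUnit (sylv m d n))
    (i : Fin (m + 1)) (q : Fin m → ℝ) :
    ofFn (m + 1) d ∣
      ofFn m (subCols m (lastRows m (sylv m d n)⁻¹) i *ᵥ q) * ofFn (m + 1) n -
        X ^ (i : ℕ) * ofFn m q := by
  rw [ofFn_mulVec, ofFn_eq_sum_C_mul_X_pow q, Finset.sum_mul, Finset.mul_sum,
    ← Finset.sum_sub_distrib]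
  refine Finset.dvd_sum fun c _ => ?_
  have h := bezout_sylv_inv_col hS ⟨(i : ℕ) + c, by omega⟩
  refine ⟨-(C (q c) * ofFn m fun r => (sylv m d n)⁻¹ (Fin.castAdd m r) ⟨(i : ℕ) + c, by omega⟩), ?_⟩
  simp only [subCols]
  rw [pow_add] at h
  linear_combination C (q c) * h

theorem dvd_ofFn_subCols_mul_subCols_mulVec {m : ℕ} {d n : Fin (m + 1) → ℝ}
    (hS : IsUnit (sylv m d n)) (i j : Fin (m + 1)) (q : Fin m → ℝ) :
    ofFn (m + 1) d ∣
      ofFn m ((subCols m (lastRows m (sylv m d n)⁻¹) i *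
        subCols m (lastRows m (sylv m d n)⁻¹) j) *ᵥ q) * ofFn (m + 1) n ^ 2 -
        X ^ ((i : ℕ) + j) * ofFn m q := by
  rw [← mulVec_mulVec]
  obtain ⟨s, hs⟩ := dvd_ofFn_subCols_mulVec hS j q
  obtain ⟨t, ht⟩ := dvd_ofFn_subCols_mulVec hS i
    (subCols m (lastRows m (sylv m d n)⁻¹) j *ᵥ q)
  refine ⟨ofFn (m + 1) n * t + X ^ (i : ℕ) * s, ?_⟩
  rw [pow_add]
  linear_combination ofFn (m + 1) n * ht + X ^ (i : ℕ) * hs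

theorem eq_of_ofFn_dvd_sub {m : ℕ} {d : Fin (m + 1) → ℝ} (hd : d (Fin.last m) ≠ 0)
    {v w : Fin m → ℝ} (h : ofFn (m + 1) d ∣ ofFn m v - ofFn m w) : v = w := by
  rw [← map_sub] at h
  have hdeg : (m : WithBot ℕ) ≤ (ofFn (m + 1) d).degree := by
    refine le_degree_of_ne_zero ?_
    rw [ofFn_coeff_eq_val_of_lt d (by omega)]
    exact hd
  have h0 := eq_zero_of_dvd_of_degree_lt h ((ofFn_degree_lt _).trans_le hdeg)
  exact sub_eq_zero.1 (injective_ofFn m (h0.trans (map_zero _).symm))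

theorem subCols_mul_subCols_eq {m : ℕ} (hm : 1 ≤ m) {d n : Fin (m + 1) → ℝ}
    (hd : d (Fin.last m) ≠ 0) (hS : IsUnit (sylv m d n)) {i j i' j' : Fin (m + 1)}
    (hij : (i : ℕ) + j = i' + j') :
    subCols m (lastRows m (sylv m d n)⁻¹) i * subCols m (lastRows m (sylv m d n)⁻¹) j =
      subCols m (lastRows m (sylv m d n)⁻¹) i' * subCols m (lastRows m (sylv m d n)⁻¹) j' := by
  refine ext_iff_mulVec.2 fun q => eq_of_ofFn_dvd_sub hd ?_
  refine ((isCoprime_of_isUnit_sylv hm hS).pow_right (n := 2)).dvd_of_dvd_mul_right ?_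
  have h := dvd_sub (dvd_ofFn_subCols_mul_subCols_mulVec hS i j q)
    (dvd_ofFn_subCols_mul_subCols_mulVec hS i' j' q)
  rwa [hij, sub_sub_sub_cancel_right, ← sub_mul] at h

end ShiftProduct

theorem bSub_shift_product (m : ℕ) (hm : 1 ≤ m) (d n : Fin (m + 1) → ℝ) (hd : ∀ k, d k ≠ 0) (hn : ∀ k, n k ≠ 0)
    (hS : IsUnit (sylv m d n)) (hD : IsUnit (dMat m d)) :
    ∀ i j : Fin (m + 1), ∀ l : ℤ,
      ∀ (h1 : 0 ≤ ((i : ℕ) : ℤ) + l) (h2 : ((i : ℕ) : ℤ) + l ≤ (m : ℤ))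
        (h3 : 0 ≤ ((j : ℕ) : ℤ) - l) (h4 : ((j : ℕ) : ℤ) - l ≤ (m : ℤ)),
        subCols m (lastRows m (sylv m d n)⁻¹) i * subCols m (lastRows m (sylv m d n)⁻¹) j =
          subCols m (lastRows m (sylv m d n)⁻¹) ⟨(((i : ℕ) : ℤ) + l).toNat, by omega⟩ *
            subCols m (lastRows m (sylv m d n)⁻¹) ⟨(((j : ℕ) : ℤ) - l).toNat, by omega⟩ := by
  intro i j l h1 h2 h3 h4
  exact subCols_mul_subCols_eq hm (hd _) hS (by simp only; omega)
end
end
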